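/- The set of isomorphism classes of R₄-modules of the form Coker φ, where φ ranges over all 3×3 matrices over S whose entries are homogeneous linear forms and whose determinant equals f₄, has cardinality exactly 72. (These are precisely the isomorphism classes of rank-one Ulrich modules over R₄.) -/

import Mathlib

open MvPolynomial Matrix TensorProduct

set_option maxHeartbeats 1000000
set_option synthInstance.maxHeartbeats 400000

noncomputable section

/-- The polynomial ring `S = K[Y₁,Y₂,Y₃,Y₄]`. -/
abbrev S (K : Type) [Field K] := MvPolynomial (Fin 4) K

/-- The variables `Y₁,…,Y₄` (indexed by `1,…,4`). -/
def Yv (K : Type) [Field K] : ℕ → S K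
  | 1 => X 0
  | 2 => X 1
  | 3 => X 2
  | 4 => X 3
  | _ => 0

/-- `f₄ = Y₁³+Y₂³+Y₃³+Y₄³`. -/
def f4 (K : Type) [Field K] : S K :=
  Yv K 1 ^ 3 + Yv K 2 ^ 3 + Yv K 3 ^ 3 + Yv K 4 ^ 3

/-- The hypersurface ring `R₄ = S/(f₄)`. -/
abbrev R4 (K : Type) [Field K] := S K ⧸ Ideal.span {f4 K}

/-- The canonical projection `S → R₄`. -/
abbrev proj (K : Type) [Field K] : S K →+* R4 K := Ideal.Quotient.mk (Ideal.span {f4 K})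

/-- The `R₄`-linear map `R₄ⁿ → R₄ⁿ` induced by an `n × n` matrix over `S`. -/
abbrev mbar (K : Type) [Field K] {n : ℕ} (M : Matrix (Fin n) (Fin n) (S K)) :
    (Fin n → R4 K) →ₗ[R4 K] (Fin n → R4 K) :=
  Matrix.mulVecLin (M.map ⇑(proj K))

/-- The cokernel of the `R₄`-linear map induced by a matrix over `S`. -/
abbrev coker (K : Type) [Field K] {n : ℕ} (M : Matrix (Fin n) (Fin n) (S K)) :=
  (Fin n → R4 K) ⧸ LinearMap.range (mbar K M)

/-- The matrix `φ_ij(a,b)`. -/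
def phiM (K : Type) [Field K] (a b : K) (i j s : ℕ) : Matrix (Fin 2) (Fin 2) (S K) :=
  !![Yv K 1 - C a * Yv K s, -(Yv K i ^ 2 + C b * Yv K i * Yv K j + C b ^ 2 * Yv K j ^ 2);
     Yv K i - C b * Yv K j, Yv K 1 ^ 2 + C a * Yv K 1 * Yv K s + C a ^ 2 * Yv K s ^ 2]

/-- The matrix `ψ_ij(a,b)`. -/
def psiM (K : Type) [Field K] (a b : K) (i j s : ℕ) : Matrix (Fin 2) (Fin 2) (S K) :=
  !![Yv K 1 ^ 2 + C a * Yv K 1 * Yv K s + C a ^ 2 * Yv K s ^ 2,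
       Yv K i ^ 2 + C b * Yv K i * Yv K j + C b ^ 2 * Yv K j ^ 2;
     -(Yv K i - C b * Yv K j), Yv K 1 - C a * Yv K s]

/-- The set `𝓛_i` of linear forms `Y_i - a Y_j` with `a³ = -1` and `i < j ≤ 4`. -/
def Lset (K : Type) [Field K] (i : ℕ) : Set (S K) :=
  {p | ∃ (a : K) (j : ℕ), a ^ 3 = -1 ∧ i < j ∧ j ≤ 4 ∧ p = Yv K i - C a * Yv K j}

/-- The matrix `α(b,c,d,ε)`, where `a = ε²bcd`. -/
def alphaM (K : Type) [Field K] (b c d ε : K) : Matrix (Fin 3) (Fin 3) (S K) :=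
  let a := ε ^ 2 * b * c * d
  !![0, Yv K 1 - C a * Yv K 4, Yv K 2 - C b * Yv K 3;
     Yv K 1 - C c * Yv K 2, -(C (b ^ 2) * Yv K 3) - C (a * b * c ^ 2 * ε ^ 2) * Yv K 4,
       C (b ^ 2 * c ^ 2) * Yv K 3 - C (a * b * c * ε ^ 2) * Yv K 4;
     Yv K 3 - C d * Yv K 4, C (c ^ 2) * Yv K 2 + C (b * c ^ 2) * Yv K 3 + C (a * c) * Yv K 4,
       -(Yv K 1) - C c * Yv K 2 - C a * Yv K 4]

/-- The matrix `β(b,c,d,ε)`, the transpose of `α(b,c,d,ε)`. -/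
def betaM (K : Type) [Field K] (b c d ε : K) : Matrix (Fin 3) (Fin 3) (S K) :=
  (alphaM K b c d ε).transpose

/-- The matrix `η(a,b,c,ε)`. -/
def etaM (K : Type) [Field K] (a b c ε : K) : Matrix (Fin 3) (Fin 3) (S K) :=
  !![0, Yv K 1 + Yv K 2, Yv K 3 - C a * Yv K 4;
     Yv K 1 + C ε * Yv K 2, -(Yv K 3) + C c * Yv K 4, 0;
     Yv K 3 - C b * Yv K 4, 0, -(Yv K 1) - C (ε ^ 2) * Yv K 2]

/-- The matrix `θ(a,b,c)` (denoted `ϑ(a,b,c)` in the paper). -/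
def thetaM (K : Type) [Field K] (a b c : K) : Matrix (Fin 3) (Fin 3) (S K) :=
  !![0, Yv K 1 + Yv K 3, Yv K 2 - C a * Yv K 4;
     Yv K 1 - C (a ^ 2 * b) * Yv K 3, -(Yv K 2) + C c * Yv K 4, 0;
     Yv K 2 - C b * Yv K 4, 0, -(Yv K 1) + C (a * b ^ 2) * Yv K 3]

/-- The matrix `D((a,b,c),(p,q,r))`. -/
def DM (K : Type) [Field K] (a b c p q r : K) : Matrix (Fin 3) (Fin 3) (S K) :=
  !![0, Yv K 1 - C a * Yv K 2, Yv K 3 - C p * Yv K 4;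
     Yv K 1 - C c * Yv K 2, -(Yv K 3) + C r * Yv K 4, 0;
     Yv K 3 - C q * Yv K 4, 0, -(Yv K 1) + C b * Yv K 2]

/-- `(a,b,c)` is a permutation (i.e. an enumeration) of the three cube roots of `-1` in `K`. -/
def cubePerm (K : Type) [Field K] (a b c : K) : Prop :=
  a ^ 3 = -1 ∧ b ^ 3 = -1 ∧ c ^ 3 = -1 ∧ a ≠ b ∧ a ≠ c ∧ b ≠ c


/-! ### Passage between matrices of linear forms and quadruples of matrices over `K` -/

/-- coefficient matrix of the variable `v`. -/
def coeffM {K : Type} [Field K] (φ : Matrix (Fin 3) (Fin 3) (S K)) (v : Fin 4) :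
    Matrix (Fin 3) (Fin 3) K :=
  fun i j => coeff (Finsupp.single v 1) (φ i j)

/-- matrix of linear forms with given coefficient matrices. -/
def ofM {K : Type} [Field K] (M : Fin 4 → Matrix (Fin 3) (Fin 3) K) :
    Matrix (Fin 3) (Fin 3) (S K) :=
  fun i j => ∑ v, C (M v i j) * X v

lemma ofM_homog {K : Type} [Field K] (M : Fin 4 → Matrix (Fin 3) (Fin 3) K) (i j : Fin 3) :
    (ofM M i j).IsHomogeneous 1 := by
  unfold ofM
  apply IsHomogeneous.sum
  intro v _
  simpa using (isHomogeneous_C _ (M v i j)).mul (isHomogeneous_X K v)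

lemma coeffM_ofM {K : Type} [Field K] (M : Fin 4 → Matrix (Fin 3) (Fin 3) K) (v : Fin 4) :
    coeffM (ofM M) v = M v := by
  ext i j
  simp only [coeffM, ofM, coeff_sum, coeff_C_mul, coeff_X, Finsupp.single_left_inj one_ne_zero]
  simp

lemma linform_eq {K : Type} [Field K] (p : S K) (hp : p.IsHomogeneous 1) :
    p = ∑ v, C (coeff (Finsupp.single v 1) p) * X v := by
  ext d
  by_cases hd : d.degree = 1
  · have hd' : d ∈ Set.range (fun a : Fin 4 => Finsupp.single a 1) := by
      rw [Finsupp.range_single_one]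
      exact hd
    obtain ⟨w, rfl⟩ := hd'
    dsimp only
    simp only [coeff_sum, coeff_C_mul, coeff_X, Finsupp.single_left_inj one_ne_zero]
    simp
  · rw [hp.coeff_eq_zero hd]
    symm
    have : (∑ v, C (coeff (Finsupp.single v 1) p) * X v : S K).IsHomogeneous 1 := by
      apply IsHomogeneous.sum
      intro v _
      simpa using (isHomogeneous_C _ (coeff (Finsupp.single v 1) p)).mul (isHomogeneous_X K v)
    exact this.coeff_eq_zero hd

lemma ofM_coeffM {K : Type} [Field K] (φ : Matrix (Fin 3) (Fin 3) (S K))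
    (h : ∀ i j, (φ i j).IsHomogeneous 1) : ofM (coeffM φ) = φ := by
  ext1 i j
  exact (linform_eq _ (h i j)).symm

lemma eval_det_ofM {K : Type} [Field K] (M : Fin 4 → Matrix (Fin 3) (Fin 3) K) (y : Fin 4 → K) :
    eval y (ofM M).det = (∑ v, y v • M v).det := by
  rw [RingHom.map_det]
  congr 1
  ext i j
  simp [ofM, Matrix.sum_apply, mul_comm]

lemma eval_f4 {K : Type} [Field K] (y : Fin 4 → K) :
    eval y (f4 K) = y 0 ^ 3 + y 1 ^ 3 + y 2 ^ 3 + y 3 ^ 3 := by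
  simp [f4, Yv]

lemma det_ofM_iff {K : Type} [Field K] [CharZero K] (M : Fin 4 → Matrix (Fin 3) (Fin 3) K) :
    (ofM M).det = f4 K ↔
      ∀ y : Fin 4 → K, (∑ v, y v • M v).det = y 0 ^ 3 + y 1 ^ 3 + y 2 ^ 3 + y 3 ^ 3 := by
  constructor
  · intro h y
    rw [← eval_det_ofM, h, eval_f4]
  · intro h
    apply MvPolynomial.funext
    intro y
    rw [eval_det_ofM, h, eval_f4]

/-- Equivalent matrices have isomorphic cokernels. -/
lemma coker_equiv {K : Type} [Field K] (M N : Fin 4 → Matrix (Fin 3) (Fin 3) K)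
    (P Q : Matrix (Fin 3) (Fin 3) K) (hP : IsUnit P.det) (hQ : IsUnit Q.det)
    (h : ∀ v, P * M v = N v * Q) :
    Nonempty (coker K (ofM M) ≃ₗ[R4 K] coker K (ofM N)) := by
  let g : K →+* R4 K := (proj K).comp C
  have hP' : IsUnit (P.map g).det := by
    have := hP.map g
    rwa [RingHom.map_det] at this
  have hQ' : IsUnit (Q.map g).det := by
    have := hQ.map g
    rwa [RingHom.map_det] at this
  have key : P.map g * (ofM M).map (proj K) = (ofM N).map (proj K) * Q.map g := by
    have h1 : P.map C * ofM M = ofM N * Q.map C := by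
      ext1 i j
      simp only [Matrix.mul_apply, Matrix.map_apply, ofM, Finset.mul_sum, Finset.sum_mul]
      rw [Finset.sum_comm, Finset.sum_comm (s := (Finset.univ : Finset (Fin 3)))]
      refine Finset.sum_congr rfl fun v _ => ?_
      have := congrArg (fun A => C (σ := Fin 4) (A i j) * X v) (h v)
      simp only [Matrix.mul_apply, map_sum, map_mul, Finset.sum_mul] at this
      convert this using 2 <;> ring
    have := congrArg (fun A => A.map (proj K)) h1
    simp only [Matrix.map_mul, Matrix.map_map] at this
    exact this
  let eP : (Fin 3 → R4 K) ≃ₗ[R4 K] (Fin 3 → R4 K) :=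
    Matrix.toLinearEquiv' (P.map g) ((Matrix.invertibleOfIsUnitDet _ hP'))
  refine ⟨Submodule.Quotient.equiv _ _ eP ?_⟩
  have heP : ∀ x, eP x = (P.map g) *ᵥ x := fun x => rfl
  apply le_antisymm
  · rintro _ ⟨_, ⟨x, rfl⟩, rfl⟩
    refine ⟨(Q.map g) *ᵥ x, ?_⟩
    simp only [mbar, Matrix.mulVecLin_apply, LinearEquiv.coe_coe, heP, Matrix.mulVec_mulVec, key]
  · rintro _ ⟨x, rfl⟩
    refine ⟨(ofM M).map (proj K) *ᵥ ((Q.map g)⁻¹ *ᵥ x), ⟨_, rfl⟩, ?_⟩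
    simp only [mbar, Matrix.mulVecLin_apply, LinearEquiv.coe_coe, heP, Matrix.mulVec_mulVec]
    rw [← Matrix.mul_assoc, key, Matrix.mul_assoc, Matrix.mul_nonsing_inv _ hQ', Matrix.mul_one]

/-- A homomorphism of cokernels lifts to matrices. -/
lemma lift_hom {K : Type} [Field K] (φ ψ : Matrix (Fin 3) (Fin 3) (S K))
    (e : coker K φ →ₗ[R4 K] coker K ψ) :
    ∃ A : Matrix (Fin 3) (Fin 3) (S K), ∀ x : Fin 3 → S K,
      e (Submodule.Quotient.mk (fun i => proj K (x i))) =
        Submodule.Quotient.mk (fun i => proj K ((A *ᵥ x) i)) := by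
  have h1 : ∀ j : Fin 3, ∃ a : Fin 3 → S K,
      e (Submodule.Quotient.mk (Pi.single j 1)) =
        Submodule.Quotient.mk (fun i => proj K (a i)) := by
    intro j
    obtain ⟨b, hb⟩ := Submodule.Quotient.mk_surjective _ (e (Submodule.Quotient.mk (Pi.single j 1)))
    choose a ha using fun i => Ideal.Quotient.mk_surjective (b i)
    refine ⟨a, ?_⟩
    rw [← hb]
    congr 1
    ext1 i
    exact (ha i).symm
  choose a ha using h1
  refine ⟨fun i j => a j i, fun x => ?_⟩
  have hx : (fun i => proj K (x i)) = ∑ j, proj K (x j) • (Pi.single j 1 : Fin 3 → R4 K) := by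
    ext1 i
    simp [Finset.sum_apply, Pi.single_apply]
  rw [hx, ← Submodule.mkQ_apply, map_sum, map_sum]
  simp only [map_smul, Submodule.mkQ_apply, ha]
  simp only [← Submodule.mkQ_apply, ← map_smul, ← map_sum]
  congr 1
  ext1 i
  simp [Finset.sum_apply, Matrix.mulVec, dotProduct, mul_comm]

lemma mem_range_lift {K : Type} [Field K] (ψ : Matrix (Fin 3) (Fin 3) (S K)) (hψ : ψ.det = f4 K)
    (x : Fin 3 → S K)
    (h : (Submodule.Quotient.mk (fun i => proj K (x i)) : coker K ψ) = 0) :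
    ∃ b : Fin 3 → S K, x = ψ *ᵥ b := by
  rw [Submodule.Quotient.mk_eq_zero] at h
  obtain ⟨b, hb⟩ := h
  choose b' hb' using fun i => Ideal.Quotient.mk_surjective (b i)
  have h2 : ∀ i, ∃ c, x i - (ψ *ᵥ b') i = c * f4 K := by
    intro i
    have : proj K (x i) = proj K ((ψ *ᵥ b') i) := by
      rw [← congrFun hb i]
      simp [Matrix.mulVec, dotProduct, ← hb']
    rw [Ideal.Quotient.eq, Ideal.mem_span_singleton'] at this
    obtain ⟨c, hc⟩ := this
    exact ⟨c, hc.symm⟩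
  choose c hc using h2
  refine ⟨b' + ψ.adjugate *ᵥ c, ?_⟩
  rw [Matrix.mulVec_add, Matrix.mulVec_mulVec, Matrix.mul_adjugate, hψ]
  ext1 i
  have := hc i
  simp only [Pi.add_apply, Matrix.smul_mulVec, Matrix.one_mulVec, Pi.smul_apply, smul_eq_mul]
  linear_combination this

lemma coeff_single_mul {K : Type} [Field K] (p q : S K) (v : Fin 4) :
    coeff (Finsupp.single v 1) (p * q) =
      constantCoeff p * coeff (Finsupp.single v 1) q +
        coeff (Finsupp.single v 1) p * constantCoeff q := by
  classical
  rw [coeff_mul, Finsupp.antidiagonal_single]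
  simp [Finset.Nat.antidiagonal_succ, constantCoeff_eq]

/-- Isomorphic cokernels come from equivalent matrices. -/
lemma equiv_of_coker {K : Type} [Field K] (M N : Fin 4 → Matrix (Fin 3) (Fin 3) K)
    (hN : (ofM N).det = f4 K)
    (e : coker K (ofM M) ≃ₗ[R4 K] coker K (ofM N)) :
    ∃ P Q : Matrix (Fin 3) (Fin 3) K, IsUnit P.det ∧ ∀ v, P * M v = N v * Q := by
  obtain ⟨A, hA⟩ := lift_hom _ _ e.toLinearMap
  obtain ⟨A', hA'⟩ := lift_hom _ _ e.symm.toLinearMap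
  have hcc : ∀ (L : Fin 4 → Matrix (Fin 3) (Fin 3) K) i j, constantCoeff (ofM L i j) = 0 := by
    intro L i j
    simp [ofM]
  have h1 : ∀ j : Fin 3, ∃ b : Fin 3 → S K, A *ᵥ (fun i => ofM M i j) = ofM N *ᵥ b := by
    intro j
    apply mem_range_lift _ hN
    rw [← hA]
    have : (Submodule.Quotient.mk (fun i => proj K (ofM M i j)) : coker K (ofM M)) = 0 := by
      rw [Submodule.Quotient.mk_eq_zero]
      refine ⟨Pi.single j 1, ?_⟩
      ext1 i
      simp
    rw [this, map_zero]
  choose b hb using h1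
  have h2 : ∀ j : Fin 3, ∃ b : Fin 3 → S K,
      A *ᵥ (A' *ᵥ (Pi.single j 1)) - Pi.single j 1 = ofM N *ᵥ b := by
    intro j
    apply mem_range_lift _ hN
    have := hA (A' *ᵥ (Pi.single j 1))
    rw [← hA'] at this
    simp only [LinearEquiv.coe_coe, LinearEquiv.apply_symm_apply] at this
    have h3 : (fun i => proj K ((A *ᵥ (A' *ᵥ (Pi.single j 1)) - Pi.single j 1 : Fin 3 → S K) i))
      = (fun i => proj K ((A *ᵥ (A' *ᵥ (Pi.single j 1))) i)) -
        (fun i => proj K ((Pi.single j 1 : Fin 3 → S K) i)) := by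
      ext1 i
      simp only [Pi.sub_apply, map_sub]
    rw [h3, Submodule.Quotient.mk_sub, this, sub_self]
  choose b2 hb2 using h2
  refine ⟨A.map constantCoeff, Matrix.of fun i j => constantCoeff (b j i), ?_, ?_⟩
  · have : A.map constantCoeff * A'.map constantCoeff = 1 := by
      ext i j
      have := congrArg constantCoeff (congrFun (hb2 j) i)
      simp only [Pi.sub_apply, Matrix.mulVec_single_one, map_sub] at this
      simp only [Matrix.mulVec, dotProduct, map_sum, map_mul, hcc, zero_mul,
        Finset.sum_const_zero] at this
      simp only [Matrix.mul_apply, Matrix.map_apply]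
      rw [sub_eq_zero] at this
      refine Eq.trans this ?_
      rw [Pi.single_apply, Matrix.one_apply]
      split_ifs <;> simp
    exact (Matrix.isUnit_iff_isUnit_det _).1 (IsUnit.of_mul_eq_one _ this)
  · intro v
    ext i j
    have := congrArg (coeff (Finsupp.single v 1)) (congrFun (hb j) i)
    simp only [Matrix.mulVec, dotProduct, coeff_sum, coeff_single_mul, hcc, mul_zero, zero_mul,
      add_zero, zero_add] at this
    have hc : ∀ (L : Fin 4 → Matrix (Fin 3) (Fin 3) K) i j,
        coeff (Finsupp.single v 1) (ofM L i j) = L v i j := fun L i j =>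
      congrFun (congrFun (coeffM_ofM L v) i) j
    simp only [hc] at this
    rw [Matrix.mul_apply, Matrix.mul_apply]
    exact this

/-! ### Normal forms -/

/-- off-diagonal matrix -/
def offd {K : Type} [Field K] (a b : Fin 3 → K) : Matrix (Fin 3) (Fin 3) K :=
  !![0, a 0, b 2; b 0, 0, a 1; a 2, b 1, 0]

/-- normal form: the coefficients of `Y₁, Y₂` are diagonal, those of `Y₃, Y₄` off-diagonal. -/
def nf {K : Type} [Field K] (ω : K) (p p' : Fin 3 → K × K) : Fin 4 → Matrix (Fin 3) (Fin 3) K :=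
  ![!![1, 0, 0; 0, ω, 0; 0, 0, ω ^ 2], !![1, 0, 0; 0, ω ^ 2, 0; 0, 0, ω],
    offd (fun n => (p n).1) (fun n => (p' n).1), offd (fun n => (p n).2) (fun n => (p' n).2)]

/-- value of a binary linear form -/
def ev {K : Type} [Field K] (p : K × K) (y z : K) : K := p.1 * y + p.2 * z

/-- the system of equations satisfied by the off-diagonal entries -/
def Sol {K : Type} [Field K] (p p' : Fin 3 → K × K) : Prop :=
  ∀ y z, ev (p 0) y z * ev (p' 0) y z = ev (p 1) y z * ev (p' 1) y z ∧
    ev (p 1) y z * ev (p' 1) y z = ev (p 2) y z * ev (p' 2) y z ∧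
    ev (p 0) y z * ev (p 1) y z * ev (p 2) y z + ev (p' 0) y z * ev (p' 1) y z * ev (p' 2) y z
      = y ^ 3 + z ^ 3

/-- torus equivalence -/
def TE {K : Type} [Field K] (p p' q q' : Fin 3 → K × K) : Prop :=
  ∃ τ : Fin 3 → K, (∀ n, τ n ≠ 0) ∧ τ 0 * τ 1 * τ 2 = 1 ∧
    ∀ n, p n = τ n • q n ∧ q' n = τ n • p' n

lemma det_nf {K : Type} [Field K] [CharZero K] (ω : K) (hω : ω ^ 2 + ω + 1 = 0)
    (p p' : Fin 3 → K × K) (h : Sol p p') : (ofM (nf ω p p')).det = f4 K := by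
  rw [det_ofM_iff]
  intro y
  obtain ⟨h1, h2, h3⟩ := h (y 2) (y 3)
  simp only [ev] at h1 h2 h3
  have w3 : ω ^ 3 = 1 := by linear_combination (ω - 1) * hω
  rw [Matrix.det_fin_three]
  simp only [nf, offd, Fin.sum_univ_four, Matrix.add_apply, Matrix.smul_apply, smul_eq_mul,
    Matrix.cons_val_zero, Matrix.cons_val_one, Matrix.cons_val, Matrix.of_apply]
  have hl : (y 0 + y 1) * (ω * y 0 + ω ^ 2 * y 1) * (ω ^ 2 * y 0 + ω * y 1) = y 0 ^ 3 + y 1 ^ 3 := by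
    linear_combination (y 0 ^ 3 + y 1 ^ 3 + (1 + ω) * (y 0 ^ 2 * y 1 + y 0 * y 1 ^ 2)) * w3 +
      (y 0 ^ 2 * y 1 + y 0 * y 1 ^ 2) * hω
  linear_combination hl + h3 + (ω ^ 2 * y 0 + ω * y 1) * (-h1 - h2)
    + (y 0 + y 1) * (-h2)
    - (y 0 + y 1) * ((p 2).1 * y 2 + (p 2).2 * y 3) * ((p' 2).1 * y 2 + (p' 2).2 * y 3) * hω

lemma diag_plus {K : Type} [Field K] [CharZero K] (b : Matrix (Fin 3) (Fin 3) K) (E : K)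
    (h : ∀ l0 l1 l2 : K, l0 + l1 + l2 = 0 →
      (!![l0, 0, 0; 0, l1, 0; 0, 0, l2] + b).det = l0 * l1 * l2 + E) :
    b 0 0 = 0 ∧ b 1 1 = 0 ∧ b 2 2 = 0 ∧ b 0 1 * b 1 0 = b 1 2 * b 2 1 ∧
      b 1 2 * b 2 1 = b 2 0 * b 0 2 ∧
      b 0 1 * b 1 2 * b 2 0 + b 1 0 * b 2 1 * b 0 2 = E := by
  simp only [Matrix.det_fin_three, Matrix.add_apply, Matrix.cons_val_zero, Matrix.cons_val_one,
    Matrix.cons_val, Matrix.of_apply] at h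
  have e0 := h 0 0 0 (by ring)
  have e1 := h 1 (-1) 0 (by ring)
  have e2 := h (-1) 1 0 (by ring)
  have e3 := h 1 0 (-1) (by ring)
  have e4 := h (-1) 0 1 (by ring)
  have e5 := h 0 1 (-1) (by ring)
  have e6 := h 0 (-1) 1 (by ring)
  have two : (2 : K) ≠ 0 := two_ne_zero
  have b2 : b 2 2 = 0 := by
    apply mul_left_cancel₀ two; linear_combination 2 * e0 - e1 - e2
  have b1 : b 1 1 = 0 := by
    apply mul_left_cancel₀ two; linear_combination 2 * e0 - e3 - e4
  have b0 : b 0 0 = 0 := by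
    apply mul_left_cancel₀ two; linear_combination 2 * e0 - e5 - e6
  simp only [b0, b1, b2] at e0 e1 e2 e3 e4 e5 e6 ⊢
  refine ⟨trivial, trivial, trivial, ?_, ?_, ?_⟩
  · linear_combination e3 - e0
  · linear_combination e0 - e1
  · linear_combination e0

lemma exists_V {K : Type} [Field K] [CharZero K] (ω : K) (hω : ω ^ 2 + ω + 1 = 0)
    (M0 M1 : Matrix (Fin 3) (Fin 3) K)
    (h : ∀ s t : K, (s • M0 + t • M1).det = s ^ 3 + t ^ 3) :
    ∃ V : Matrix (Fin 3) (Fin 3) K, V.det ≠ 0 ∧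
      M1 * V = M0 * V * !![1, 0, 0; 0, ω, 0; 0, 0, ω ^ 2] := by
  have w3 : ω ^ 3 = 1 := by linear_combination (ω - 1) * hω
  have hM0 : M0.det = 1 := by simpa using h 1 0
  have hv : ∀ d : K, d ^ 3 = 1 → ∃ v : Fin 3 → K, v ≠ 0 ∧ M1 *ᵥ v = d • (M0 *ᵥ v) := by
    intro d hd
    have : (d • M0 + (-1 : K) • M1).det = 0 := by rw [h, hd]; ring
    obtain ⟨v, hv0, hv⟩ := Matrix.exists_mulVec_eq_zero_iff.2 this
    refine ⟨v, hv0, ?_⟩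
    rw [Matrix.add_mulVec, Matrix.smul_mulVec, Matrix.smul_mulVec, neg_one_smul] at hv
    exact (sub_eq_zero.1 (by rw [sub_eq_add_neg]; exact hv)).symm
  obtain ⟨v0, h00, h0⟩ := hv 1 (by ring)
  obtain ⟨v1, h10, h1⟩ := hv ω w3
  obtain ⟨v2, h20, h2⟩ := hv (ω ^ 2) (by linear_combination (ω ^ 3 + 1) * w3)
  let V : Matrix (Fin 3) (Fin 3) K := Matrix.of fun i j => (![v0, v1, v2] j) i
  have hVD : M1 * V = M0 * V * !![1, 0, 0; 0, ω, 0; 0, 0, ω ^ 2] := by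
    rw [Matrix.mul_assoc]
    have e0 := fun i => congrFun h0 i
    have e1 := fun i => congrFun h1 i
    have e2 := fun i => congrFun h2 i
    simp only [Matrix.mulVec, dotProduct, Fin.sum_univ_three, Pi.smul_apply, smul_eq_mul] at e0 e1 e2
    ext i j
    fin_cases j
    · simp [Matrix.mul_apply, Fin.sum_univ_three, V]
      linear_combination e0 i
    · simp [Matrix.mul_apply, Fin.sum_univ_three, V]
      linear_combination e1 i
    · simp [Matrix.mul_apply, Fin.sum_univ_three, V]
      linear_combination e2 i
  refine ⟨V, ?_, hVD⟩
  intro hdet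
  obtain ⟨c, hc0, hc⟩ := Matrix.exists_mulVec_eq_zero_iff.2 hdet
  have step : ∀ c : Fin 3 → K, V *ᵥ c = 0 →
      V *ᵥ (!![1, 0, 0; 0, ω, 0; 0, 0, ω ^ 2] *ᵥ c) = 0 := by
    intro c hc
    have : M0 *ᵥ (V *ᵥ (!![1, 0, 0; 0, ω, 0; 0, 0, ω ^ 2] *ᵥ c)) = 0 := by
      rw [Matrix.mulVec_mulVec, Matrix.mulVec_mulVec, ← hVD,
        ← Matrix.mulVec_mulVec, hc, Matrix.mulVec_zero]
    exact Matrix.eq_zero_of_mulVec_eq_zero (by rw [hM0]; exact one_ne_zero) this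
  have hc1 := step _ hc
  have hc2 := step _ hc1
  have f0 := fun i => congrFun hc i
  have f1 := fun i => congrFun hc1 i
  have f2 := fun i => congrFun hc2 i
  simp [Matrix.mulVec, dotProduct, Fin.sum_univ_three, V] at f0 f1 f2
  have three : (3 : K) ≠ 0 := three_ne_zero
  apply hc0
  have c0 : ∀ i, v0 i * c 0 = 0 := by
    intro i
    apply mul_left_cancel₀ three
    linear_combination f0 i + f1 i + f2 i - (v1 i * c 1 + v2 i * c 2 * (ω ^ 2 - ω + 1)) * hω
  have c1 : ∀ i, v1 i * c 1 = 0 := by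
    intro i
    apply mul_left_cancel₀ three
    linear_combination f0 i + ω ^ 2 * f1 i + ω * f2 i - v0 i * c 0 * hω - 2 * v1 i * c 1 * w3
      - v2 i * c 2 * (ω ^ 3 - ω + 1) * hω
  have c2 : ∀ i, v2 i * c 2 = 0 := by
    intro i
    apply mul_left_cancel₀ three
    linear_combination f0 i + ω * f1 i + ω ^ 2 * f2 i - v0 i * c 0 * hω
      - v1 i * c 1 * (ω ^ 2 - ω + 1) * hω - v2 i * c 2 * (ω ^ 3 + 2) * w3
  have nz : ∀ (v : Fin 3 → K) (x : K), v ≠ 0 → (∀ i, v i * x = 0) → x = 0 := by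
    intro v x hv hx
    by_contra hne
    exact hv (funext fun i => (mul_eq_zero.1 (hx i)).resolve_right hne)
  ext i
  fin_cases i
  · exact nz _ _ h00 c0
  · exact nz _ _ h10 c1
  · exact nz _ _ h20 c2

lemma reduce_nf {K : Type} [Field K] [CharZero K] (ω : K) (hω : ω ^ 2 + ω + 1 = 0)
    (M : Fin 4 → Matrix (Fin 3) (Fin 3) K)
    (h : ∀ y : Fin 4 → K, (∑ v, y v • M v).det = y 0 ^ 3 + y 1 ^ 3 + y 2 ^ 3 + y 3 ^ 3) :
    ∃ p p' : Fin 3 → K × K, Sol p p' ∧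
      ∃ P Q : Matrix (Fin 3) (Fin 3) K, IsUnit P.det ∧ IsUnit Q.det ∧
        ∀ v, P * M v = nf ω p p' v * Q := by
  have w3 : ω ^ 3 = 1 := by linear_combination (ω - 1) * hω
  have w0 : ω ≠ 0 := by
    rintro rfl
    simp at w3
  obtain ⟨V, hV, hMV⟩ := exists_V ω hω (M 0) (M 1) (by
    intro s t
    have := h ![s, t, 0, 0]
    simpa [Fin.sum_univ_four] using this)
  have hM0 : (M 0).det = 1 := by
    have := h ![1, 0, 0, 0]
    simpa [Fin.sum_univ_four] using this
  have hVu : IsUnit V.det := isUnit_iff_ne_zero.2 hV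
  have hM0u : IsUnit (M 0).det := by rw [hM0]; exact isUnit_one
  set D : Matrix (Fin 3) (Fin 3) K := !![1, 0, 0; 0, ω, 0; 0, 0, ω ^ 2] with hD
  have hDdet : D.det = 1 := by
    rw [hD, Matrix.det_fin_three]
    simp
    linear_combination w3
  set P : Matrix (Fin 3) (Fin 3) K := D * (V⁻¹ * (M 0)⁻¹) with hP
  have hPV : P.det * V.det = 1 := by
    rw [hP, Matrix.det_mul, Matrix.det_mul, hDdet, one_mul, mul_right_comm, ← Matrix.det_mul,
      Matrix.nonsing_inv_mul _ hVu, Matrix.det_one, one_mul, Matrix.det_nonsing_inv, hM0]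
    simp
  set N : Fin 4 → Matrix (Fin 3) (Fin 3) K := fun v => P * M v * V with hN
  have hN0 : N 0 = D := by
    simp only [hN, hP, Matrix.mul_assoc]
    rw [← Matrix.mul_assoc (M 0)⁻¹, Matrix.nonsing_inv_mul _ hM0u, Matrix.one_mul,
      Matrix.nonsing_inv_mul _ hVu, Matrix.mul_one]
  have hN1 : N 1 = D * D := by
    simp only [hN, Matrix.mul_assoc, hMV]
    simp only [hP, Matrix.mul_assoc]
    rw [← Matrix.mul_assoc (M 0)⁻¹, Matrix.nonsing_inv_mul _ hM0u, Matrix.one_mul,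
      ← Matrix.mul_assoc V⁻¹, Matrix.nonsing_inv_mul _ hVu, Matrix.one_mul]
  have hdet : ∀ y : Fin 4 → K, (∑ v, y v • N v).det = y 0 ^ 3 + y 1 ^ 3 + y 2 ^ 3 + y 3 ^ 3 := by
    intro y
    have : ∑ v, y v • N v = P * (∑ v, y v • M v) * V := by
      simp only [hN, Matrix.mul_sum, Matrix.sum_mul, Matrix.mul_smul, Matrix.smul_mul]
    rw [this, Matrix.det_mul, Matrix.det_mul, h]
    linear_combination (y 0 ^ 3 + y 1 ^ 3 + y 2 ^ 3 + y 3 ^ 3) * hPV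
  have key : ∀ s t : K, _ := fun s t => diag_plus (s • N 2 + t • N 3) (s ^ 3 + t ^ 3) (by
    intro l0 l1 l2 hl
    have three : (3 : K) ≠ 0 := three_ne_zero
    obtain ⟨a, b, rfl, rfl, rfl⟩ : ∃ a b : K, l0 = a + b ∧ l1 = ω * a + ω ^ 2 * b ∧
        l2 = ω ^ 2 * a + ω * b := by
      refine ⟨(l0 + ω ^ 2 * l1 + ω * l2) / 3, (l0 + ω * l1 + ω ^ 2 * l2) / 3, ?_, ?_, ?_⟩
      · field_simp
        linear_combination hl - (l1 + l2) * hω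
      · field_simp
        linear_combination hl - l0 * hω - 2 * l1 * w3 - l2 * (ω ^ 2 - ω + 1) * hω
      · field_simp
        linear_combination hl - l0 * (ω ^ 2 - ω + 1) * hω - l1 * (ω ^ 3 - ω + 1) * hω
          - l2 * (ω ^ 3 + 2) * w3
          + (ω * l0 + ω ^ 2 * l1 + ω ^ 3 * l2) * w3
    have := hdet ![a, b, s, t]
    simp only [Fin.sum_univ_four, Matrix.cons_val_zero, Matrix.cons_val_one, Matrix.cons_val,
      hN0, hN1] at this
    have e : (!![a + b, 0, 0; 0, ω * a + ω ^ 2 * b, 0; 0, 0, ω ^ 2 * a + ω * b] :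
        Matrix (Fin 3) (Fin 3) K) = a • D + b • (D * D) := by
      ext i j
      fin_cases i <;> fin_cases j <;> simp [hD]
      · ring
      · linear_combination (-b * ω) * w3
    rw [e, ← add_assoc, this]
    linear_combination -(a ^ 3 + b ^ 3 + (1 + ω) * (a ^ 2 * b + a * b ^ 2)) * w3 -
      (a ^ 2 * b + a * b ^ 2) * hω)
  let p : Fin 3 → K × K := ![(N 2 0 1, N 3 0 1), (N 2 1 2, N 3 1 2), (N 2 2 0, N 3 2 0)]
  let p' : Fin 3 → K × K := ![(N 2 1 0, N 3 1 0), (N 2 2 1, N 3 2 1), (N 2 0 2, N 3 0 2)]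
  refine ⟨p, p', ?_, P, V⁻¹, ?_, ?_, ?_⟩
  · intro y z
    obtain ⟨-, -, -, h1, h2, h3⟩ := key y z
    simp only [Matrix.add_apply, Matrix.smul_apply, smul_eq_mul] at h1 h2 h3
    simp only [p, p', ev, Matrix.cons_val_zero, Matrix.cons_val_one, Matrix.cons_val]
    refine ⟨?_, ?_, ?_⟩
    · linear_combination h1
    · linear_combination h2
    · linear_combination h3
  · exact IsUnit.of_mul_eq_one _ hPV
  · exact Matrix.isUnit_nonsing_inv_det _ hVu
  · have hNn : nf ω p p' = N := by
      obtain ⟨a0, a1, a2, -⟩ := key 1 0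
      obtain ⟨b0, b1, b2, -⟩ := key 0 1
      simp only [one_smul, zero_smul, add_zero, zero_add] at a0 a1 a2 b0 b1 b2
      ext v i j
      fin_cases v
      · simp [nf, hN0, hD]
      · have : (!![1, 0, 0; 0, ω ^ 2, 0; 0, 0, ω] : Matrix (Fin 3) (Fin 3) K) = D * D := by
          ext i j
          fin_cases i <;> fin_cases j <;> simp [hD, Matrix.mul_apply, Fin.sum_univ_three]
          · ring
          · linear_combination (-ω) * w3
        simp [nf, hN1, this]
      · fin_cases i <;> fin_cases j <;> simp [nf, offd, p, p', a0, a1, a2]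
      · fin_cases i <;> fin_cases j <;> simp [nf, offd, p, p', b0, b1, b2]
    intro v
    rw [hNn]
    simp only [hN]
    rw [Matrix.mul_assoc (P * M v), Matrix.mul_nonsing_inv _ hVu, Matrix.mul_one]

lemma nf_of_TE {K : Type} [Field K] (ω : K) (p p' q q' : Fin 3 → K × K) (h : TE p p' q q') :
    ∃ P Q : Matrix (Fin 3) (Fin 3) K, IsUnit P.det ∧ IsUnit Q.det ∧
        ∀ v, P * nf ω p p' v = nf ω q q' v * Q := by
  obtain ⟨τ, h0, h1, h⟩ := h
  have hu : IsUnit (!![1, 0, 0; 0, τ 0, 0; 0, 0, τ 0 * τ 1] : Matrix (Fin 3) (Fin 3) K).det := by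
    rw [Matrix.det_fin_three]
    simp [h0]
  refine ⟨_, _, hu, hu, ?_⟩
  have a := fun n => congrArg Prod.fst (h n).1
  have b := fun n => congrArg Prod.snd (h n).1
  have c := fun n => congrArg Prod.fst (h n).2
  have d := fun n => congrArg Prod.snd (h n).2
  simp only [Prod.smul_fst, Prod.smul_snd, smul_eq_mul] at a b c d
  intro v
  ext i j
  fin_cases v <;> fin_cases i <;> fin_cases j <;>
    simp [nf, offd, Matrix.mul_apply, Fin.sum_univ_three, a, b, c, d] <;> 
    first 
    | ring1
    | linear_combination (q 2).1 * h1
    | linear_combination (q 2).2 * h1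
    | linear_combination (-(p' 2).1) * h1
    | linear_combination (-(p' 2).2) * h1

lemma TE_of_nf {K : Type} [Field K] (ω : K) (hω : ω ^ 2 + ω + 1 = 0) [CharZero K]
    (p p' q q' : Fin 3 → K × K)
    (P Q : Matrix (Fin 3) (Fin 3) K) (hP : IsUnit P.det)
    (h : ∀ v, P * nf ω p p' v = nf ω q q' v * Q) : TE p p' q q' := by
  have w3 : ω ^ 3 = 1 := by linear_combination (ω - 1) * hω
  have w1 : ω - 1 ≠ 0 := by
    intro h
    have : (3 : K) = 0 := by linear_combination hω - (ω + 2) * h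
    exact three_ne_zero this
  have w0 : ω ≠ 0 := by
    rintro rfl
    simp at w3
  have e0 := fun i j => congrFun (congrFun (h 0) i) j
  have e1 := fun i j => congrFun (congrFun (h 1) i) j
  have e2 := fun i j => congrFun (congrFun (h 2) i) j
  have e3 := fun i j => congrFun (congrFun (h 3) i) j
  simp only [nf, offd, Matrix.mul_apply, Fin.sum_univ_three, Matrix.cons_val_zero,
    Matrix.cons_val_one, Matrix.cons_val, Matrix.of_apply] at e0 e1 e2 e3
  have a01 := e0 0 1
  have a02 := e0 0 2
  have a10 := e0 1 0
  have a12 := e0 1 2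
  have a20 := e0 2 0
  have a21 := e0 2 1
  have a00 := e0 0 0
  have a11 := e0 1 1
  have a22 := e0 2 2
  have b01 := e1 0 1
  have b02 := e1 0 2
  have b10 := e1 1 0
  have b12 := e1 1 2
  have b20 := e1 2 0
  have b21 := e1 2 1
  simp at a01 a02 a10 a12 a20 a21 a00 a11 a22 b01 b02 b10 b12 b20 b21
  have ww : ω * (ω - 1) ≠ 0 := mul_ne_zero w0 w1
  have P01 : P 0 1 = 0 := by
    apply (mul_eq_zero.1 _).resolve_left ww; linear_combination b01 - a01
  have P02 : P 0 2 = 0 := by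
    apply (mul_eq_zero.1 _).resolve_left ww; linear_combination a02 - b02
  have Q10 : Q 1 0 = 0 := by
    apply (mul_eq_zero.1 _).resolve_left ww; linear_combination a10 - b10
  have Q20 : Q 2 0 = 0 := by
    apply (mul_eq_zero.1 _).resolve_left ww; linear_combination b20 - a20
  have P12 : P 1 2 = 0 := by
    apply (mul_eq_zero.1 _).resolve_left w1; linear_combination b12 - ω * a12 + P 1 2 * w3
  have P21 : P 2 1 = 0 := by
    apply (mul_eq_zero.1 _).resolve_left w1; linear_combination a21 - ω * b21 + P 2 1 * w3
  have Q01 : Q 0 1 = 0 := by rw [← a01, P01, zero_mul]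
  have Q02 : Q 0 2 = 0 := by rw [← a02, P02, zero_mul]
  have P10 : P 1 0 = 0 := by rw [a10, Q10, mul_zero]
  have P20 : P 2 0 = 0 := by rw [a20, Q20, mul_zero]
  have Q12 : Q 1 2 = 0 := by
    apply (mul_eq_zero.1 _).resolve_left w0; rw [← a12, P12, zero_mul]
  have Q21 : Q 2 1 = 0 := by
    apply (mul_eq_zero.1 _).resolve_left w0; rw [← b21, P21, zero_mul]
  have Q00 : Q 0 0 = P 0 0 := a00.symm
  have Q11 : Q 1 1 = P 1 1 := by
    apply mul_left_cancel₀ w0; linear_combination -a11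
  have Q22 : Q 2 2 = P 2 2 := by
    apply mul_left_cancel₀ (pow_ne_zero 2 w0); linear_combination -a22
  rw [Matrix.det_fin_three, P01, P02, P12, P10, P20, P21] at hP
  have hP := hP.ne_zero
  have p0 : P 0 0 ≠ 0 := by intro h; apply hP; rw [h]; ring
  have p1 : P 1 1 ≠ 0 := by intro h; apply hP; rw [h]; ring
  have p2 : P 2 2 ≠ 0 := by intro h; apply hP; rw [h]; ring
  have c01 := e2 0 1
  have c12 := e2 1 2
  have c20 := e2 2 0
  have c10 := e2 1 0
  have c21 := e2 2 1
  have c02 := e2 0 2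
  have d01 := e3 0 1
  have d12 := e3 1 2
  have d20 := e3 2 0
  have d10 := e3 1 0
  have d21 := e3 2 1
  have d02 := e3 0 2
  simp [P01, P02, P12, P10, P20, P21, Q01, Q02, Q12, Q10, Q20, Q21, Q00, Q11, Q22]
    at c01 c12 c20 c10 c21 c02 d01 d12 d20 d10 d21 d02
  refine ⟨![P 1 1 / P 0 0, P 2 2 / P 1 1, P 0 0 / P 2 2], ?_, ?_, ?_⟩
  · intro n
    fin_cases n <;> simp [p0, p1, p2]
  · simp
    field_simp
  · intro n
    fin_cases n
    · refine ⟨Prod.ext ?_ ?_, Prod.ext ?_ ?_⟩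
      · simp; field_simp; linear_combination c01
      · simp; field_simp; linear_combination d01
      · simp; field_simp; linear_combination -c10
      · simp; field_simp; linear_combination -d10
    · refine ⟨Prod.ext ?_ ?_, Prod.ext ?_ ?_⟩
      · simp; field_simp; linear_combination c12
      · simp; field_simp; linear_combination d12
      · simp; field_simp; linear_combination -c21
      · simp; field_simp; linear_combination -d21
    · refine ⟨Prod.ext ?_ ?_, Prod.ext ?_ ?_⟩
      · simp; field_simp; linear_combination c20
      · simp; field_simp; linear_combination d20
      · simp; field_simp; linear_combination -c02
      · simp; field_simp; linear_combination -d02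

/-! ### The index set and the representatives -/

/-- the three indices are distinct and at least two -/
def goodA (s : Fin 3 → Fin 5) : Prop :=
  (∀ n, 2 ≤ s n) ∧ s 0 ≠ s 1 ∧ s 1 ≠ s 2 ∧ s 2 ≠ s 0

/-- constant patterns `0`, `1`, or two-valued patterns with values at least two -/
def goodB (s : Fin 3 → Fin 5) : Prop :=
  (∀ n, s n = 0) ∨ (∀ n, s n = 1) ∨ ((∀ n, 2 ≤ s n) ∧
    ((s 0 = s 1 ∧ s 1 ≠ s 2) ∨ (s 1 = s 2 ∧ s 2 ≠ s 0) ∨ (s 2 = s 0 ∧ s 0 ≠ s 1)))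

instance : DecidablePred goodA := fun s => by unfold goodA; infer_instance
instance : DecidablePred goodB := fun s => by unfold goodB; infer_instance

/-- the complementary pattern -/
def partner (s : Fin 3 → Fin 5) (n : Fin 3) : Fin 5 :=
  if s n = 0 then 1 else if s n = 1 then 0 else
    if s 0 ≠ s n then s 0 else if s 1 ≠ s n then s 1 else s 2

/-- index type of the classes -/
abbrev Idx := ({s // goodA s} × Bool) ⊕ ({s // goodB s} × Fin 3)

lemma card_goodA : Fintype.card {s // goodA s} = 6 := by decide +kernel

lemma card_goodB : Fintype.card {s // goodB s} = 20 := by decide +kernel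

lemma card_Idx : Fintype.card Idx = 72 := by
  simp [Fintype.card_sum, Fintype.card_prod, card_goodA, card_goodB]

/-- the five basic linear forms -/
def eL {K : Type} [Field K] (ω : K) : Fin 5 → K × K :=
  ![(1, 0), (0, 1), (-1, -1), (-ω, -ω ^ 2), (-ω ^ 2, -ω)]

/-- upper cycle of the representatives -/
def rP {K : Type} [Field K] (ω : K) : Idx → Fin 3 → K × K
  | Sum.inl (s, true), n => -eL ω (s.1 n)
  | Sum.inl (_, false), _ => 0
  | Sum.inr (s, _), n => eL ω (s.1 n)

/-- lower cycle of the representatives -/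
def rP' {K : Type} [Field K] (ω : K) : Idx → Fin 3 → K × K
  | Sum.inl (_, true), _ => 0
  | Sum.inl (s, false), n => -eL ω (s.1 n)
  | Sum.inr (s, c), n => ω ^ c.1 • eL ω (partner s.1 n)

lemma w_ne {K : Type} [Field K] [CharZero K] (ω : K) (hω : ω ^ 2 + ω + 1 = 0) :
    ω ^ 3 = 1 ∧ ω ≠ 0 ∧ ω - 1 ≠ 0 := by
  have w3 : ω ^ 3 = 1 := by linear_combination (ω - 1) * hω
  refine ⟨w3, ?_, ?_⟩
  · rintro rfl
    simp at w3
  · intro h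
    have : (3 : K) = 0 := by linear_combination hω - (ω + 2) * h
    exact three_ne_zero this

lemma ev_smul {K : Type} [Field K] (a : K) (p : K × K) (y z : K) :
    ev (a • p) y z = a * ev p y z := by
  simp [ev]; ring

lemma ev_neg {K : Type} [Field K] (p : K × K) (y z : K) : ev (-p) y z = - ev p y z := by
  simp [ev]; ring

lemma ev_zero {K : Type} [Field K] (y z : K) : ev (0 : K × K) y z = 0 := by
  simp [ev]

lemma cases_ij (i j : Fin 5) (hi : 2 ≤ i) (hj : 2 ≤ j) (hij : i ≠ j) :
    (i = 2 ∧ j = 3) ∨ (i = 2 ∧ j = 4) ∨ (i = 3 ∧ j = 2) ∨ (i = 3 ∧ j = 4) ∨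
      (i = 4 ∧ j = 2) ∨ (i = 4 ∧ j = 3) := by
  revert i j; decide

lemma prod_two {K : Type} [Field K] [CharZero K] (ω : K) (hω : ω ^ 2 + ω + 1 = 0)
    (i j : Fin 5) (hi : 2 ≤ i) (hj : 2 ≤ j) (hij : i ≠ j) (y z : K) :
    ev (eL ω i) y z * ev (eL ω j) y z * (ev (eL ω i) y z + ev (eL ω j) y z) = y ^ 3 + z ^ 3 := by
  obtain ⟨w3, -, -⟩ := w_ne ω hω
  have w2 : ω ^ 2 = - ω - 1 := by linear_combination hω
  rcases cases_ij i j hi hj hij with ⟨rfl, rfl⟩ | ⟨rfl, rfl⟩ | ⟨rfl, rfl⟩ | ⟨rfl, rfl⟩ |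
      ⟨rfl, rfl⟩ | ⟨rfl, rfl⟩ <;>
    simp only [eL, ev, Matrix.cons_val_zero, Matrix.cons_val_one, Matrix.cons_val, w2] <;>
    ring_nf <;> simp only [w3, w2] <;> ring

lemma sum_three {K : Type} [Field K] [CharZero K] (ω : K) (hω : ω ^ 2 + ω + 1 = 0)
    (i j k : Fin 5) (hi : 2 ≤ i) (hj : 2 ≤ j) (hk : 2 ≤ k) (hij : i ≠ j) (hjk : j ≠ k)
    (hki : k ≠ i) (y z : K) :
    ev (eL ω k) y z = - (ev (eL ω i) y z + ev (eL ω j) y z) := by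
  have hk' : (i = 2 ∧ j = 3 ∧ k = 4) ∨ (i = 2 ∧ j = 4 ∧ k = 3) ∨ (i = 3 ∧ j = 2 ∧ k = 4) ∨
      (i = 3 ∧ j = 4 ∧ k = 2) ∨ (i = 4 ∧ j = 2 ∧ k = 3) ∨ (i = 4 ∧ j = 3 ∧ k = 2) := by
    rcases cases_ij i j hi hj hij with ⟨rfl, rfl⟩ | ⟨rfl, rfl⟩ | ⟨rfl, rfl⟩ | ⟨rfl, rfl⟩ |
      ⟨rfl, rfl⟩ | ⟨rfl, rfl⟩ <;> fin_cases k <;> simp_all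
  have w2 : ω ^ 2 = - ω - 1 := by linear_combination hω
  rcases hk' with ⟨rfl, rfl, rfl⟩ | ⟨rfl, rfl, rfl⟩ | ⟨rfl, rfl, rfl⟩ | ⟨rfl, rfl, rfl⟩ |
      ⟨rfl, rfl, rfl⟩ | ⟨rfl, rfl, rfl⟩ <;>
    simp only [eL, ev, Matrix.cons_val_zero, Matrix.cons_val_one, Matrix.cons_val, w2] <;> ring

lemma prod_three {K : Type} [Field K] [CharZero K] (ω : K) (hω : ω ^ 2 + ω + 1 = 0)
    (i j k : Fin 5) (hi : 2 ≤ i) (hj : 2 ≤ j) (hk : 2 ≤ k) (hij : i ≠ j) (hjk : j ≠ k)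
    (hki : k ≠ i) (y z : K) :
    ev (eL ω i) y z * ev (eL ω j) y z * ev (eL ω k) y z = - (y ^ 3 + z ^ 3) := by
  rw [sum_three ω hω i j k hi hj hk hij hjk hki, ← prod_two ω hω i j hi hj hij y z]
  ring

lemma eL_ne_zero {K : Type} [Field K] [CharZero K] (ω : K) (hω : ω ^ 2 + ω + 1 = 0) (i : Fin 5) :
    eL ω i ≠ 0 := by
  obtain ⟨w3, w0, w1⟩ := w_ne ω hω
  intro h
  have h1 := congrArg Prod.fst h
  have h2 := congrArg Prod.snd h
  fin_cases i <;> simp [eL, w0] at h1 h2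

/-- the five linear forms are pairwise non-proportional -/
lemma eL_prop {K : Type} [Field K] [CharZero K] (ω : K) (hω : ω ^ 2 + ω + 1 = 0) (i j : Fin 5)
    (h : (eL ω i).1 * (eL ω j).2 = (eL ω i).2 * (eL ω j).1) : i = j := by
  obtain ⟨w3, w0, w1⟩ := w_ne ω hω
  have ww : ω * (ω - 1) ≠ 0 := mul_ne_zero w0 w1
  by_contra hij
  fin_cases i <;> fin_cases j <;> simp [eL, w0] at h hij <;>
    first
    | (apply ww; linear_combination h)
    | (apply ww; linear_combination -h)
    | (apply ww; linear_combination h + ω * w3)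
    | (apply ww; linear_combination -h + ω * w3)
    | (apply w1; linear_combination h - ω * w3)
    | (apply w1; linear_combination h + ω * w3)
    | (apply w1; linear_combination -h - ω * w3)
    | (apply w1; linear_combination -h + ω * w3)

lemma rep_Sol {K : Type} [Field K] [CharZero K] (ω : K) (hω : ω ^ 2 + ω + 1 = 0) (k : Idx) :
    Sol (rP ω k) (rP' ω k) := by
  obtain ⟨w3, w0, w1⟩ := w_ne ω hω
  intro y z
  rcases k with ⟨⟨s, hs, h01, h12, h20⟩, b⟩ | ⟨⟨s, hs⟩, c⟩
  · have := prod_three ω hω _ _ _ (hs 0) (hs 1) (hs 2) h01 h12 h20 y z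
    cases b
    · simp only [rP, rP', ev_neg, ev_zero]
      refine ⟨by ring, by ring, by linear_combination -this⟩
    · simp only [rP, rP', ev_neg, ev_zero]
      refine ⟨by ring, by ring, by linear_combination -this⟩
  · have hc : (ω ^ c.1) ^ 3 = 1 := by rw [← pow_mul, mul_comm, pow_mul, w3, one_pow]
    simp only [rP, rP', ev_smul]
    generalize ω ^ c.1 = c at *
    rcases hs with hs | hs | ⟨h2, hs⟩
    · simp [partner, hs, eL, ev]
      linear_combination z ^ 3 * hc
    · simp [partner, hs, eL, ev]
      linear_combination y ^ 3 * hc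
    · have n0 : ∀ n, s n ≠ 0 := by
        intro n h
        have := h2 n
        rw [h] at this
        exact absurd this (by decide)
      have n1 : ∀ n, s n ≠ 1 := by
        intro n h
        have := h2 n
        rw [h] at this
        exact absurd this (by decide)
      rcases hs with ⟨a, b⟩ | ⟨a, b⟩ | ⟨a, b⟩
      · have q0 : partner s 0 = s 2 := by simp [partner, n0, n1, a]
        have q1 : partner s 1 = s 2 := by simp [partner, n0, n1, a]
        have q2 : partner s 2 = s 1 := by simp [partner, n0, n1, a, b]
        rw [q0, q1, q2, a]
        have := prod_two ω hω (s 1) (s 2) (h2 1) (h2 2) b y z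
        refine ⟨by ring, by ring, ?_⟩
        linear_combination this + ev (eL ω (s 2)) y z ^ 2 * ev (eL ω (s 1)) y z * hc
      · have q0 : partner s 0 = s 2 := by simp [partner, n0, n1, a, b]
        have q1 : partner s 1 = s 0 := by simp [partner, n0, n1, a, b.symm]
        have q2 : partner s 2 = s 0 := by simp [partner, n0, n1, b.symm]
        rw [q0, q1, q2, a]
        have := prod_two ω hω (s 2) (s 0) (h2 2) (h2 0) b y z
        refine ⟨by ring, by ring, ?_⟩
        linear_combination this + ev (eL ω (s 0)) y z ^ 2 * ev (eL ω (s 2)) y z * hc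
      · have q0 : partner s 0 = s 1 := by simp [partner, n0, n1, b.symm]
        have q1 : partner s 1 = s 0 := by simp [partner, n0, n1, b]
        have q2 : partner s 2 = s 1 := by simp [partner, n0, n1, a, b.symm]
        rw [q0, q1, q2, a]
        have := prod_two ω hω (s 0) (s 1) (h2 0) (h2 1) b y z
        refine ⟨by ring, by ring, ?_⟩
        linear_combination this + ev (eL ω (s 1)) y z ^ 2 * ev (eL ω (s 0)) y z * hc

/-- distinct representatives are not torus equivalent -/
lemma rep_inj {K : Type} [Field K] [CharZero K] (ω : K) (hω : ω ^ 2 + ω + 1 = 0) (k l : Idx)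
    (h : TE (rP ω k) (rP' ω k) (rP ω l) (rP' ω l)) : k = l := by
  obtain ⟨w3, w0, w1⟩ := w_ne ω hω
  obtain ⟨τ, h0, h1, h⟩ := h
  have hprop : ∀ (i j : Fin 5) (a : K), eL ω i = a • eL ω j → i = j := by
    intro i j a hh
    apply eL_prop ω hω
    rw [hh]
    simp
    ring
  have hnz := eL_ne_zero ω hω
  rcases k with ⟨⟨s, hs⟩, b⟩ | ⟨⟨s, hs⟩, c⟩ <;> rcases l with ⟨⟨t, ht⟩, b'⟩ | ⟨⟨t, ht⟩, c'⟩
  · cases b <;> cases b' <;> simp only [rP, rP'] at h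
    · have : s = t := by
        ext1 n
        symm
        apply hprop _ _ (τ n)
        have := (h n).2
        rw [smul_neg, neg_inj] at this
        exact this
      subst this
      rfl
    · have := (h 0).2
      simp [h0, hnz] at this
    · have := (h 0).1
      simp [hnz] at this
    · have : s = t := by
        ext1 n
        apply hprop _ _ (τ n)
        have := (h n).1
        rw [smul_neg, neg_inj] at this
        exact this
      subst this
      rfl
  · cases b <;> simp only [rP, rP'] at h
    · have := (h 0).1
      exact absurd (smul_eq_zero.1 this.symm) (by simp [h0, hnz])
    · have := (h 0).2
      simp [w0, hnz] at this
  · cases b' <;> simp only [rP, rP'] at h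
    · have := (h 0).1
      simp [hnz] at this
    · have := (h 0).2
      exact absurd (smul_eq_zero.1 this.symm) (by simp [w0, h0, hnz])
  · simp only [rP, rP'] at h
    have hst : s = t := by
      ext1 n
      exact hprop _ _ _ (h n).1
    subst hst
    have t0 : τ 0 = 1 := by
      have := (h 0).1
      have h2 : (τ 0 - 1) • eL ω (s 0) = 0 := by rw [sub_smul, one_smul, ← this, sub_self]
      rw [smul_eq_zero] at h2
      exact sub_eq_zero.1 (h2.resolve_right (hnz _))
    have h2 := (h 0).2
    rw [t0, one_smul] at h2
    have h3 : (ω ^ c'.1 - ω ^ c.1) • eL ω (partner s 0) = 0 := by rw [sub_smul, h2, sub_self]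
    rw [smul_eq_zero] at h3
    have h4 := h3.resolve_right (hnz _)
    have : c = c' := by
      by_contra hne
      have ww : ω * (ω - 1) ≠ 0 := mul_ne_zero w0 w1
      fin_cases c <;> fin_cases c' <;> simp at h4 hne <;>
        first
        | (apply w1; linear_combination h4)
        | (apply w1; linear_combination -h4)
        | (apply ww; linear_combination h4)
        | (apply ww; linear_combination -h4)
        | (apply w1; linear_combination -ω * h4 + w3)
        | (apply w1; linear_combination ω * h4 + w3)
    subst this
    rfl

/-! ### Classification of the solutions -/

lemma root_prop {K : Type} [Field K] (p q : K × K) (hp : p ≠ 0) (h : ev q p.2 (-p.1) = 0) :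
    ∃ β : K, q = β • p := by
  obtain ⟨p1, p2⟩ := p
  obtain ⟨q1, q2⟩ := q
  simp only [ev] at h
  by_cases h1 : p1 = 0
  · have h2 : p2 ≠ 0 := by
      rintro rfl
      exact hp (by simp [h1])
    refine ⟨q2 / p2, ?_⟩
    subst h1
    have : q1 = 0 := by
      have : q1 * p2 = 0 := by linear_combination h
      exact (mul_eq_zero.1 this).resolve_right h2
    ext <;> simp
    · exact this
    · field_simp
  · refine ⟨q1 / p1, ?_⟩
    ext <;> simp <;> field_simp
    linear_combination -h

lemma ev_root {K : Type} [Field K] (p : K × K) : ev p p.2 (-p.1) = 0 := by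
  simp only [ev]; ring

lemma ev_mul_zero {K : Type} [Field K] (p q : K × K) (h : ∀ y z, ev p y z * ev q y z = 0) :
    p = 0 ∨ q = 0 := by
  obtain ⟨p1, p2⟩ := p
  obtain ⟨q1, q2⟩ := q
  have h1 := h 1 0
  have h2 := h 0 1
  have h3 := h 1 1
  simp only [ev] at h1 h2 h3
  simp at h1 h2
  rcases h1 with rfl | rfl <;> rcases h2 with rfl | rfl <;> simp at h3 <;> simp [h3]

lemma ev_sub {K : Type} [Field K] (p q : K × K) (y z : K) :
    ev (p - q) y z = ev p y z - ev q y z := by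
  simp [ev]; ring

lemma pattern {K : Type} [Field K] (x x' y y' : K × K) (hx : x ≠ 0) (hy : y ≠ 0) (hy' : y' ≠ 0)
    (h : ∀ s t, ev x s t * ev x' s t = ev y s t * ev y' s t) :
    ∃ β : K, β ≠ 0 ∧ ((y = β • x ∧ y' = β⁻¹ • x') ∨ (y = β • x' ∧ y' = β⁻¹ • x)) := by
  have h0 := h x.2 (-x.1)
  rw [ev_root, zero_mul] at h0
  rcases mul_eq_zero.1 h0.symm with h1 | h1
  · obtain ⟨β, rfl⟩ := root_prop x y hx h1
    have hβ : β ≠ 0 := by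
      rintro rfl
      simp at hy
    refine ⟨β, hβ, Or.inl ⟨rfl, ?_⟩⟩
    have := ev_mul_zero x (x' - β • y') (by
      intro s t
      have := h s t
      rw [ev_smul] at this
      rw [ev_sub, ev_smul]
      linear_combination this)
    have h3 := sub_eq_zero.1 (this.resolve_left hx)
    rw [h3, smul_smul, inv_mul_cancel₀ hβ, one_smul]
  · obtain ⟨β, rfl⟩ := root_prop x y' hx h1
    have hβ : β ≠ 0 := by
      rintro rfl
      simp at hy'
    refine ⟨β⁻¹, inv_ne_zero hβ, Or.inr ⟨?_, by rw [inv_inv]⟩⟩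
    have := ev_mul_zero x (x' - β • y) (by
      intro s t
      have := h s t
      rw [ev_smul] at this
      rw [ev_sub, ev_smul]
      linear_combination this)
    have h3 := sub_eq_zero.1 (this.resolve_left hx)
    rw [h3, smul_smul, inv_mul_cancel₀ hβ, one_smul]

lemma root_e {K : Type} [Field K] [CharZero K] (ω : K) (hω : ω ^ 2 + ω + 1 = 0) (p : K × K)
    (hp : p ≠ 0) (h : p.2 ^ 3 + (-p.1) ^ 3 = 0) : ∃ i : Fin 5, 2 ≤ i ∧ ∃ a : K, p = a • eL ω i := by
  have h1 := prod_three ω hω 2 3 4 (by decide) (by decide) (by decide) (by decide) (by decide)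
    (by decide) p.2 (-p.1)
  rw [h, neg_zero] at h1
  have key : ∀ i, ev (eL ω i) p.2 (-p.1) = 0 → ∃ a : K, p = a • eL ω i := by
    intro i hi
    obtain ⟨β, hβ⟩ := root_prop p _ hp hi
    have hb : β ≠ 0 := by
      rintro rfl
      rw [zero_smul] at hβ
      exact eL_ne_zero ω hω _ hβ
    refine ⟨β⁻¹, ?_⟩
    rw [hβ, smul_smul, inv_mul_cancel₀ hb, one_smul]
  rcases mul_eq_zero.1 h1 with h1 | h1
  · rcases mul_eq_zero.1 h1 with h1 | h1
    · exact ⟨2, by decide, key _ h1⟩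
    · exact ⟨3, by decide, key _ h1⟩
  · exact ⟨4, by decide, key _ h1⟩

lemma not_cube {K : Type} [Field K] [CharZero K] (κ : K) (p : K × K)
    (h : ∀ y z, κ * ev p y z ^ 3 = y ^ 3 + z ^ 3) : False := by
  have h1 := h 1 0
  have h3 := h 1 1
  have h4 := h 1 (-1)
  simp only [ev] at h1 h3 h4
  have hκ : κ ≠ 0 := by
    rintro rfl
    simp at h1
  have h5 : (p.1 * 1 + p.2 * (-1)) ^ 3 = 0 := by
    have : κ * (p.1 * 1 + p.2 * (-1)) ^ 3 = 0 := by rw [h4]; ring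
    exact (mul_eq_zero.1 this).resolve_left hκ
  have h6 : p.2 = p.1 := by
    have := pow_eq_zero_iff (three_ne_zero) |>.1 h5
    linear_combination -this
  rw [h6] at h3
  have : (6 : K) = 0 := by linear_combination h3 - 8 * h1
  norm_num at this

lemma exists_point {K : Type} [Field K] (p q : K × K) (h : p.1 * q.2 ≠ p.2 * q.1) (s t : K) :
    ∃ y z, ev p y z = s ∧ ev q y z = t := by
  have h' : p.1 * q.2 - p.2 * q.1 ≠ 0 := sub_ne_zero.2 h
  refine ⟨(s * q.2 - t * p.2) / (p.1 * q.2 - p.2 * q.1),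
    (t * p.1 - s * q.1) / (p.1 * q.2 - p.2 * q.1), ?_, ?_⟩ <;>
  · simp only [ev]
    rw [mul_div_assoc', mul_div_assoc', ← add_div, div_eq_iff h']
    ring

lemma two_core {K : Type} [Field K] [CharZero K] (ω : K) (hω : ω ^ 2 + ω + 1 = 0)
    (P Q : K × K) (hP : P ≠ 0) (hQ : Q ≠ 0) (u v : K)
    (h : ∀ y z, ev P y z * ev Q y z * (u * ev P y z + v * ev Q y z) = y ^ 3 + z ^ 3) :
    ∃ i j : Fin 5, 2 ≤ i ∧ 2 ≤ j ∧ i ≠ j ∧ ∃ a b : K, P = a • eL ω i ∧ Q = b • eL ω j ∧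
      a * b * (u * a) = 1 ∧ a * b * (v * b) = 1 := by
  obtain ⟨i, hi, a, rfl⟩ := root_e ω hω P hP (by rw [← h, ev_root]; ring)
  obtain ⟨j, hj, b, rfl⟩ := root_e ω hω Q hQ (by rw [← h, ev_root]; ring)
  have hij : i ≠ j := by
    rintro rfl
    apply not_cube (a * b * (u * a + v * b)) (eL ω i)
    intro y z
    rw [← h y z]
    simp only [ev_smul]
    ring
  have hd : (eL ω i).1 * (eL ω j).2 ≠ (eL ω i).2 * (eL ω j).1 := fun hh => hij (eL_prop ω hω i j hh)
  have two : (2 : K) ≠ 0 := two_ne_zero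
  obtain ⟨y1, z1, e1, e2⟩ := exists_point _ _ hd 1 1
  obtain ⟨y2, z2, e3, e4⟩ := exists_point _ _ hd 1 (-1)
  have k1 := (h y1 z1).trans (prod_two ω hω i j hi hj hij y1 z1).symm
  have k2 := (h y2 z2).trans (prod_two ω hω i j hi hj hij y2 z2).symm
  simp only [ev_smul, e1, e2, e3, e4] at k1 k2
  refine ⟨i, j, hi, hj, hij, a, b, rfl, rfl, ?_, ?_⟩
  · apply mul_left_cancel₀ two
    linear_combination k1 - k2
  · apply mul_left_cancel₀ two
    linear_combination k1 + k2

lemma cube_core {K : Type} [Field K] [CharZero K] (ω : K)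
    (P Q : K × K) (hP : P ≠ 0) (u v : K) (hu : u ≠ 0) (hv : v ≠ 0)
    (h : ∀ y z, u * ev P y z ^ 3 + v * ev Q y z ^ 3 = y ^ 3 + z ^ 3) :
    ∃ i j : Fin 5, ((i = 0 ∧ j = 1) ∨ (i = 1 ∧ j = 0)) ∧ ∃ a b : K, P = a • eL ω i ∧
      Q = b • eL ω j ∧ u * a ^ 3 = 1 ∧ v * b ^ 3 = 1 := by
  have hD : ev Q P.2 (-P.1) ≠ 0 := by
    intro h0
    obtain ⟨β, rfl⟩ := root_prop P Q hP h0
    apply not_cube (u + v * β ^ 3) P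
    intro y z
    rw [← h y z, ev_smul]
    ring
  obtain ⟨p1, p2⟩ := P
  obtain ⟨q1, q2⟩ := Q
  have h1 := h 1 0
  have h2 := h 0 1
  have h3 := h 1 1
  have h4 := h 1 (-1)
  simp only [ev] at h1 h2 h3 h4 hD
  have six : (6 : K) ≠ 0 := by norm_num
  have A : u * p1 ^ 2 * p2 + v * q1 ^ 2 * q2 = 0 := by
    apply mul_left_cancel₀ six
    linear_combination h3 - h4 - 2 * h2
  have B : u * p1 * p2 ^ 2 + v * q1 * q2 ^ 2 = 0 := by
    apply mul_left_cancel₀ six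
    linear_combination h3 + h4 - 2 * h1
  have C1 : q1 * q2 = 0 := by
    have : (v * (q1 * p2 + q2 * -p1)) * (q1 * q2) = 0 := by linear_combination p2 * A - p1 * B
    exact (mul_eq_zero.1 this).resolve_left (mul_ne_zero hv hD)
  have C2 : p1 * p2 = 0 := by
    have : (u * (q1 * p2 + q2 * -p1)) * (p1 * p2) = 0 := by linear_combination q1 * B - q2 * A
    exact (mul_eq_zero.1 this).resolve_left (mul_ne_zero hu hD)
  rcases mul_eq_zero.1 C2 with rfl | rfl
  · rcases mul_eq_zero.1 C1 with rfl | rfl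
    · simp at hD
    · refine ⟨1, 0, Or.inr ⟨rfl, rfl⟩, p2, q1, by simp [eL], by simp [eL], ?_, ?_⟩
      · linear_combination h2
      · linear_combination h1
  · rcases mul_eq_zero.1 C1 with rfl | rfl
    · refine ⟨0, 1, Or.inl ⟨rfl, rfl⟩, p1, q2, by simp [eL], by simp [eL], ?_, ?_⟩
      · linear_combination h1
      · linear_combination h2
    · simp at hD

lemma cube_root {K : Type} [Field K] [CharZero K] (ω : K) (hω : ω ^ 2 + ω + 1 = 0) (c : K)
    (hc : c ^ 3 = 1) : ∃ t : Fin 3, c = ω ^ t.1 := by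
  have : (c - 1) * ((c - ω) * (c - ω ^ 2)) = 0 := by
    linear_combination hc + (-c ^ 2 + c * ω - ω + 1) * hω
  rcases mul_eq_zero.1 this with h | h
  · exact ⟨0, by simpa using sub_eq_zero.1 h⟩
  · rcases mul_eq_zero.1 h with h | h
    · exact ⟨1, by simpa using sub_eq_zero.1 h⟩
    · exact ⟨2, by simpa using sub_eq_zero.1 h⟩

lemma build {K : Type} [Field K] [CharZero K] (ω : K) (hω : ω ^ 2 + ω + 1 = 0)
    (p p' : Fin 3 → K × K) (s : Fin 3 → Fin 5) (hs : goodB s) (c : K) (hc : c ^ 3 = 1)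
    (a b : Fin 3 → K) (hp : ∀ n, p n = a n • eL ω (s n)) (hp' : ∀ n, p' n = b n • eL ω (partner s n))
    (hab : ∀ n, a n * b n = c) (ha : a 0 * a 1 * a 2 = 1) :
    ∃ k : Idx, TE p p' (rP ω k) (rP' ω k) := by
  obtain ⟨t, rfl⟩ := cube_root ω hω c hc
  refine ⟨Sum.inr (⟨s, hs⟩, t), a, ?_, ha, ?_⟩
  · intro n hn
    have := hab n
    rw [hn, zero_mul] at this
    exact pow_ne_zero _ (w_ne ω hω).2.1 this.symm
  · intro n
    simp only [rP, rP']
    refine ⟨hp n, ?_⟩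
    rw [hp', smul_smul, hab]

lemma surj_good : ∀ s : Fin 3 → Fin 5, (∀ n, 2 ≤ s n) → (∀ j, 2 ≤ j → ∃ n, s n = j) → goodA s := by
  decide +kernel

lemma three_core {K : Type} [Field K] [CharZero K] (ω : K) (hω : ω ^ 2 + ω + 1 = 0)
    (p : Fin 3 → K × K)
    (h : ∀ y z, ev (p 0) y z * ev (p 1) y z * ev (p 2) y z = y ^ 3 + z ^ 3) :
    (∀ n, p n ≠ 0) ∧ ∃ s, goodA s ∧ ∃ a : Fin 3 → K, a 0 * a 1 * a 2 = -1 ∧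
      ∀ n, p n = a n • eL ω (s n) := by
  have h0 : ∀ n, p n ≠ 0 := by
    intro n hn
    have := h 1 0
    fin_cases n <;> simp at hn <;> simp [hn, ev_zero] at this
  refine ⟨h0, ?_⟩
  have h1 : ∀ n, ∃ i : Fin 5, 2 ≤ i ∧ ∃ a : K, p n = a • eL ω i := by
    intro n
    apply root_e ω hω _ (h0 n)
    rw [← h]
    have := ev_root (p n)
    fin_cases n <;> simp at this <;> simp [this]
  choose s hs a ha using h1
  have hg : goodA s := by
    apply surj_good s hs
    intro j hj
    have hj0 := eL_ne_zero ω hω j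
    have key : ∀ n, ev (p n) (eL ω j).2 (-(eL ω j).1) = 0 → ∃ n, s n = j := by
      intro n hn
      refine ⟨n, ?_⟩
      apply eL_prop ω hω
      have han : a n ≠ 0 := by
        intro h2
        apply h0 n
        rw [ha, h2, zero_smul]
      rw [ha, ev_smul] at hn
      have := (mul_eq_zero.1 hn).resolve_left han
      simp only [ev] at this
      linear_combination this
    have e0 : (eL ω j).2 ^ 3 + (-(eL ω j).1) ^ 3 = 0 := by
      obtain ⟨k, hk, hjk⟩ : ∃ k : Fin 5, 2 ≤ k ∧ j ≠ k := by
        clear hj0 key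
        revert j; decide
      rw [← prod_two ω hω j k hj hk hjk, ev_root]
      ring
    rw [← h] at e0
    rcases mul_eq_zero.1 e0 with e0 | e0
    · rcases mul_eq_zero.1 e0 with e0 | e0
      · exact key _ e0
      · exact key _ e0
    · exact key _ e0
  refine ⟨s, hg, a, ?_, ha⟩
  obtain ⟨_, g1, g2, g3⟩ := hg
  have e1 := prod_three ω hω _ _ _ (hs 0) (hs 1) (hs 2) g1 g2 g3 1 0
  have e2 := h 1 0
  simp only [ha, ev_smul] at e2
  linear_combination -e2 + a 0 * a 1 * a 2 * e1

lemma classify_deg {K : Type} [Field K] [CharZero K] (ω : K) (hω : ω ^ 2 + ω + 1 = 0)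
    (p p' : Fin 3 → K × K) (h : Sol p p') (m : Fin 3) (hm : p m = 0 ∨ p' m = 0) :
    ∃ k : Idx, TE p p' (rP ω k) (rP' ω k) := by
  have hz : ∀ n, p n = 0 ∨ p' n = 0 := by
    intro n
    apply ev_mul_zero
    intro y z
    obtain ⟨e1, e2, -⟩ := h y z
    have em : ev (p m) y z * ev (p' m) y z = 0 := by
      rcases hm with hm | hm <;> simp [hm, ev_zero]
    have hall : ∀ n, ev (p n) y z * ev (p' n) y z = ev (p 0) y z * ev (p' 0) y z := by
      intro n
      match n with
      | 0 => rfl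
      | 1 => exact e1.symm
      | 2 => exact (e1.trans e2).symm
    rw [hall n, ← hall m, em]
  by_cases hp : ∃ n, p n = 0
  · obtain ⟨n, hn⟩ := hp
    have h3 : ∀ y z, ev (p' 0) y z * ev (p' 1) y z * ev (p' 2) y z = y ^ 3 + z ^ 3 := by
      intro y z
      rw [← (h y z).2.2]
      fin_cases n <;> simp at hn <;> simp [hn, ev_zero]
    obtain ⟨h0, s, hs, a, ha, hh⟩ := three_core ω hω p' h3
    have hpz : ∀ n, p n = 0 := fun n => (hz n).resolve_right (h0 n)
    have ha0 : ∀ n, a n ≠ 0 := by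
      intro n hn
      apply h0 n
      rw [hh, hn, zero_smul]
    refine ⟨Sum.inl (⟨s, hs⟩, false), fun n => -(a n)⁻¹, ?_, ?_, ?_⟩
    · intro n
      simp [ha0]
    · have : (a 0)⁻¹ * (a 1)⁻¹ * (a 2)⁻¹ = -1 := by
        rw [← mul_inv, ← mul_inv, ha]
        norm_num
      linear_combination -this
    · intro n
      simp only [rP, rP', hpz, smul_zero, true_and]
      rw [hh, smul_smul, neg_mul, inv_mul_cancel₀ (ha0 n), neg_smul, one_smul]
  · push Not at hp
    have hpz : ∀ n, p' n = 0 := fun n => (hz n).resolve_left (hp n)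
    have h3 : ∀ y z, ev (p 0) y z * ev (p 1) y z * ev (p 2) y z = y ^ 3 + z ^ 3 := by
      intro y z
      rw [← (h y z).2.2]
      simp [hpz, ev_zero]
    obtain ⟨h0, s, hs, a, ha, hh⟩ := three_core ω hω p h3
    have ha0 : ∀ n, a n ≠ 0 := by
      intro n hn
      apply h0 n
      rw [hh, hn, zero_smul]
    refine ⟨Sum.inl (⟨s, hs⟩, true), fun n => -(a n), ?_, ?_, ?_⟩
    · intro n
      simp [ha0]
    · linear_combination -ha
    · intro n
      simp only [rP, rP', hpz, smul_zero, and_true]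
      rw [hh, smul_neg, neg_smul, neg_neg]

lemma good_partner (i j : Fin 5) (hi : 2 ≤ i) (hj : 2 ≤ j) (hij : i ≠ j) :
    (goodB ![i, i, j] ∧ partner ![i, i, j] = ![j, j, i]) ∧
    (goodB ![i, j, i] ∧ partner ![i, j, i] = ![j, i, j]) ∧
    (goodB ![i, j, j] ∧ partner ![i, j, j] = ![j, i, i]) := by
  revert i j; decide +kernel

lemma good_const (i j : Fin 5) (hij : (i = 0 ∧ j = 1) ∨ (i = 1 ∧ j = 0)) :
    goodB ![i, i, i] ∧ partner ![i, i, i] = ![j, j, j] := by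
  revert i j; decide +kernel

lemma classify {K : Type} [Field K] [CharZero K] (ω : K) (hω : ω ^ 2 + ω + 1 = 0)
    (p p' : Fin 3 → K × K) (h : Sol p p') :
    ∃ k : Idx, TE p p' (rP ω k) (rP' ω k) := by
  by_cases hd : ∃ m, p m = 0 ∨ p' m = 0
  · obtain ⟨m, hm⟩ := hd
    exact classify_deg ω hω p p' h m hm
  push Not at hd
  obtain ⟨β, hβ, h1⟩ := pattern (p 0) (p' 0) (p 1) (p' 1) (hd 0).1 (hd 1).1 (hd 1).2
    (fun s t => (h s t).1)
  obtain ⟨γ, hγ, h2⟩ := pattern (p 0) (p' 0) (p 2) (p' 2) (hd 0).1 (hd 2).1 (hd 2).2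
    (fun s t => (h s t).1.trans (h s t).2.1)
  have h3 := fun y z => (h y z).2.2
  have hb1 : β * β⁻¹ = 1 := mul_inv_cancel₀ hβ
  have hc1 : γ * γ⁻¹ = 1 := mul_inv_cancel₀ hγ
  rcases h1 with ⟨e1, e1'⟩ | ⟨e1, e1'⟩ <;> rcases h2 with ⟨e2, e2'⟩ | ⟨e2, e2'⟩
  · obtain ⟨i, j, hij, a, b, hP, hQ, ea, eb⟩ := cube_core ω (p 0) (p' 0) (hd 0).1 (β * γ)
      (β⁻¹ * γ⁻¹) (mul_ne_zero hβ hγ) (mul_ne_zero (inv_ne_zero hβ) (inv_ne_zero hγ)) (by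
        intro y z
        rw [← h3 y z, e1, e1', e2, e2']
        simp only [ev_smul]
        ring)
    obtain ⟨g1, g2⟩ := good_const i j hij
    refine build ω hω p p' ![i, i, i] g1 (a * b) ?_ ![a, β * a, γ * a] ![b, β⁻¹ * b, γ⁻¹ * b]
      ?_ ?_ ?_ ?_
    · linear_combination (a * b) ^ 3 * (-hb1 * γ * γ⁻¹ - hc1) + ea * β⁻¹ * γ⁻¹ * b ^ 3 + eb
    · rw [hP] at e1 e2
      simp [Fin.forall_fin_succ, hP, e1, e2, smul_smul]
    · rw [hQ] at e1' e2'
      simp [g2, Fin.forall_fin_succ, hQ, e1', e2', smul_smul]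
    · simp [Fin.forall_fin_succ]
      constructor
      · linear_combination a * b * hb1
      · linear_combination a * b * hc1
    · simp
      linear_combination ea
  · obtain ⟨i, j, hi, hj, hij, a, b, hP, hQ, ea, eb⟩ := two_core ω hω (p 0) (p' 0) (hd 0).1 (hd 0).2
      (β * γ) (β⁻¹ * γ⁻¹) (by
        intro y z
        rw [← h3 y z, e1, e1', e2, e2']
        simp only [ev_smul]
        ring)
    obtain ⟨⟨g1, g2⟩, -, -⟩ := good_partner i j hi hj hij
    refine build ω hω p p' ![i, i, j] g1 (a * b) ?_ ![a, β * a, γ * b] ![b, β⁻¹ * b, γ⁻¹ * a]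
      ?_ ?_ ?_ ?_
    · linear_combination (a * b) ^ 3 * (-hb1 * γ * γ⁻¹ - hc1) + ea * β⁻¹ * γ⁻¹ * b ^ 2 * a + eb
    · rw [hP] at e1
      rw [hQ] at e2
      simp [Fin.forall_fin_succ, hP, e1, e2, smul_smul]
    · rw [hQ] at e1'
      rw [hP] at e2'
      simp [g2, Fin.forall_fin_succ, hQ, e1', e2', smul_smul]
    · simp [Fin.forall_fin_succ]
      constructor
      · linear_combination a * b * hb1
      · linear_combination a * b * hc1
    · simp
      linear_combination ea
  · obtain ⟨i, j, hi, hj, hij, a, b, hP, hQ, ea, eb⟩ := two_core ω hω (p 0) (p' 0) (hd 0).1 (hd 0).2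
      (β * γ) (β⁻¹ * γ⁻¹) (by
        intro y z
        rw [← h3 y z, e1, e1', e2, e2']
        simp only [ev_smul]
        ring)
    obtain ⟨-, ⟨g1, g2⟩, -⟩ := good_partner i j hi hj hij
    refine build ω hω p p' ![i, j, i] g1 (a * b) ?_ ![a, β * b, γ * a] ![b, β⁻¹ * a, γ⁻¹ * b]
      ?_ ?_ ?_ ?_
    · linear_combination (a * b) ^ 3 * (-hb1 * γ * γ⁻¹ - hc1) + ea * β⁻¹ * γ⁻¹ * b ^ 2 * a + eb
    · rw [hQ] at e1
      rw [hP] at e2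
      simp [Fin.forall_fin_succ, hP, e1, e2, smul_smul]
    · rw [hP] at e1'
      rw [hQ] at e2'
      simp [g2, Fin.forall_fin_succ, hQ, e1', e2', smul_smul]
    · simp [Fin.forall_fin_succ]
      constructor
      · linear_combination a * b * hb1
      · linear_combination a * b * hc1
    · simp
      linear_combination ea
  · obtain ⟨i, j, hi, hj, hij, a, b, hP, hQ, ea, eb⟩ := two_core ω hω (p 0) (p' 0) (hd 0).1 (hd 0).2
      (β⁻¹ * γ⁻¹) (β * γ) (by
        intro y z
        rw [← h3 y z, e1, e1', e2, e2']
        simp only [ev_smul]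
        ring)
    obtain ⟨-, -, g1, g2⟩ := good_partner i j hi hj hij
    refine build ω hω p p' ![i, j, j] g1 (a * b) ?_ ![a, β * b, γ * b] ![b, β⁻¹ * a, γ⁻¹ * a]
      ?_ ?_ ?_ ?_
    · linear_combination (a * b) ^ 3 * (-hb1 * γ * γ⁻¹ - hc1) + ea * β * γ * b ^ 2 * a + eb
    · rw [hQ] at e1 e2
      simp [Fin.forall_fin_succ, hP, e1, e2, smul_smul]
    · rw [hP] at e1' e2'
      simp [g2, Fin.forall_fin_succ, hQ, e1', e2', smul_smul]
    · simp [Fin.forall_fin_succ]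
      constructor
      · linear_combination a * b * hb1
      · linear_combination a * b * hc1
    · simp
      linear_combination eb

theorem stmt19 (K : Type) [Field K] [IsAlgClosed K] [CharZero K] :
    ∃ reps : Fin 72 → Matrix (Fin 3) (Fin 3) (S K),
      (∀ k, (∀ i j, (reps k i j).IsHomogeneous 1) ∧ (reps k).det = f4 K) ∧
      (∀ k l : Fin 72,
        Nonempty (coker K (reps k) ≃ₗ[R4 K] coker K (reps l)) → k = l) ∧
      (∀ φ : Matrix (Fin 3) (Fin 3) (S K),
        (∀ i j, (φ i j).IsHomogeneous 1) → φ.det = f4 K →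
          ∃ k, Nonempty (coker K φ ≃ₗ[R4 K] coker K (reps k))) := by
  obtain ⟨r, hr⟩ := IsAlgClosed.exists_pow_nat_eq (-3 : K) (n := 2) (by norm_num)
  obtain ⟨ω, hω⟩ : ∃ ω : K, ω ^ 2 + ω + 1 = 0 :=
    ⟨(-1 + r) / 2, by linear_combination (1 / 4 : K) * hr⟩
  obtain ⟨e⟩ : Nonempty (Idx ≃ Fin 72) := ⟨Fintype.equivFinOfCardEq card_Idx⟩
  refine ⟨fun k => ofM (nf ω (rP ω (e.symm k)) (rP' ω (e.symm k))), ?_, ?_, ?_⟩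
  · intro k
    exact ⟨ofM_homog _, det_nf ω hω _ _ (rep_Sol ω hω _)⟩
  · rintro k l ⟨f⟩
    obtain ⟨P, Q, hP, h⟩ := equiv_of_coker _ _ (det_nf ω hω _ _ (rep_Sol ω hω _)) f
    exact e.symm.injective (rep_inj ω hω _ _ (TE_of_nf ω hω _ _ _ _ P Q hP h))
  · intro φ hφ hdet
    rw [← ofM_coeffM φ hφ] at hdet ⊢
    obtain ⟨p, p', hs, P, Q, hP, hQ, h⟩ := reduce_nf ω hω _ ((det_ofM_iff _).1 hdet)
    obtain ⟨k, hk⟩ := classify ω hω p p' hs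
    obtain ⟨l, rfl⟩ := e.symm.surjective k
    obtain ⟨P', Q', hP', hQ', h'⟩ := nf_of_TE ω _ _ _ _ hk
    obtain ⟨f⟩ := coker_equiv _ _ P Q hP hQ h
    obtain ⟨g⟩ := coker_equiv _ _ P' Q' hP' hQ' h'
    exact ⟨l, ⟨f.trans g⟩⟩
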